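/- There do not exist vectors χ₁, …, χ₂₇ ∈ ℝ⁸, a bijection b from {1, …, 27} onto L₄, positive real numbers t₁, …, t₂₇ with χ_k = t_k·b(k) for all k, and a vector χ₀ ∈ ℝ⁸, such that for every k ∈ {1, …, 27} there exists k' ∈ {1, …, 27} with χ_k + χ_{k'} = χ₀. -/

import Mathlib

open scoped Classical

noncomputable def e8 : Fin 8 → EuclideanSpace ℝ (Fin 8) :=
  fun i => EuclideanSpace.single i (1 : ℝ)

/-- The 27-element set of Section 5.5, for `E₇` (here `e₈, e₇, e₆` are the basis
vectors of indices `7, 6, 5`, and `e_i`, `1 ≤ i ≤ 5`, those of indices `0, …, 4`). -/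
noncomputable def L₄ : Set (EuclideanSpace ℝ (Fin 8)) :=
  {-(e8 7) + e8 6} ∪
  {v | ∃ i : Fin 8, (i : ℕ) < 5 ∧ ∃ ε : ℝ, (ε = 1 ∨ ε = -1) ∧
    v = -(e8 5) + ε • e8 i} ∪
  {v | ∃ ε : Fin 5 → ℝ, (∀ i, ε i = 1 ∨ ε i = -1) ∧
    Even (Finset.univ.filter (fun i => ε i = -1)).card ∧
    v = (2 : ℝ)⁻¹ • (-(e8 7) + e8 6 - e8 5 +
      ∑ i : Fin 5, ε i • e8 (i.castLE (by norm_num)))}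

theorem sub_apply_eq_one_of_mem_L₄ {v : EuclideanSpace ℝ (Fin 8)} (hv : v ∈ L₄) :
    v 6 - v 5 = 1 := by
  rcases hv with (rfl | ⟨i, hi, ε, -, rfl⟩) | ⟨ε, -, -, rfl⟩
  · simp [e8]
  · have h5 : (5 : Fin 8) ≠ i := by rintro rfl; simp at hi
    have h6 : (6 : Fin 8) ≠ i := by rintro rfl; simp at hi
    simp [e8, h5, h6]
  · simp [e8, Fin.sum_univ_succ, Fin.ext_iff]
    norm_num

theorem inner_self_eq_two_of_mem_L₄ {v : EuclideanSpace ℝ (Fin 8)} (hv : v ∈ L₄) :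
    inner ℝ v v = 2 := by
  rcases hv with (rfl | ⟨i, hi, ε, hε, rfl⟩) | ⟨ε, hε, -, rfl⟩
  · rw [real_inner_self_eq_norm_sq, EuclideanSpace.real_norm_sq_eq]
    simp [e8, Fin.sum_univ_eight, Fin.ext_iff]
    norm_num
  · have hsq : ε * ε = 1 := by rcases hε with rfl | rfl <;> norm_num
    have h5 : (5 : Fin 8) ≠ i := by rintro rfl; simp at hi
    simp only [e8, inner_add_left, inner_add_right, inner_neg_left, inner_neg_right,
      inner_smul_left, inner_smul_right, EuclideanSpace.inner_single_left]
    simp [h5, h5.symm, hsq]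
    norm_num
  · have hsq : ∀ i, ε i ^ 2 = 1 := fun i => by rcases hε i with h | h <;> norm_num [h]
    rw [real_inner_self_eq_norm_sq, EuclideanSpace.real_norm_sq_eq]
    simp only [e8, Fin.sum_univ_eight, Fin.sum_univ_five, PiLp.smul_apply, PiLp.add_apply,
      PiLp.sub_apply, PiLp.neg_apply, PiLp.single_apply, Fin.ext_iff, Fin.val_castLE]
    norm_num
    linarith [hsq 0, hsq 1, hsq 2, hsq 3, hsq 4]

/-- Distinct vectors of the same length have inner product smaller than the squared length. -/
theorem inner_lt_of_inner_self_eq {E : Type*} [NormedAddCommGroup E] [InnerProductSpace ℝ E]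
    {x y : E} {r : ℝ} (hx : inner ℝ x x = r) (hy : inner ℝ y y = r) (hne : x ≠ y) :
    inner ℝ x y < r := by
  have h : 0 < inner ℝ (x - y) (x - y) := real_inner_self_pos.2 (sub_ne_zero.2 hne)
  rw [real_inner_sub_sub_self, hx, hy] at h
  linarith

theorem stmt18 :
    ¬ ∃ (χ : Fin 27 → EuclideanSpace ℝ (Fin 8))
        (b : Fin 27 → EuclideanSpace ℝ (Fin 8))
        (_ : Function.Injective b) (_ : Set.range b = L₄)
        (t : Fin 27 → ℝ) (_ : ∀ k, 0 < t k) (_ : ∀ k, χ k = t k • b k)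
        (χ₀ : EuclideanSpace ℝ (Fin 8)),
      ∀ k : Fin 27, ∃ k' : Fin 27, χ k + χ k' = χ₀ := by
  rintro ⟨χ, b, hb, hr, t, ht, hχ, χ₀, h⟩
  have hmem : ∀ k, b k ∈ L₄ := fun k => hr ▸ Set.mem_range_self k
  have hheight : ∀ k, χ k 6 - χ k 5 = t k := fun k => by
    have := sub_apply_eq_one_of_mem_L₄ (hmem k)
    simp only [hχ, PiLp.smul_apply, smul_eq_mul]
    rw [← mul_sub, this, mul_one]
  have hinj : Function.Injective χ := fun k l hkl => by
    have htt : t k = t l := by rw [← hheight, ← hheight, hkl]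
    rw [hχ, hχ, htt] at hkl
    exact hb (smul_right_injective _ (ht l).ne' hkl)
  choose f hf using h
  have hinv : Function.Involutive f := fun k => hinj <| by
    apply add_left_cancel (a := χ (f k))
    rw [hf (f k), add_comm, hf k]
  obtain ⟨m, hm⟩ : ∃ m, hinv.toPerm f m = m :=
    Equiv.Perm.exists_fixed_point_of_prime (p := 2) (n := 1) (by simp)
      (by ext k; simp [pow_two, hinv k])
  replace hm : f m = m := hm
  obtain ⟨k, hk⟩ : ∃ k, k ≠ m := exists_ne m
  have hfk : f k ≠ m := fun h => hk (by rw [← hinv k, h, hm])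
  have heq : χ k + χ (f k) = χ m + χ m := by
    rw [hf k, ← hf m, hm]
  have hsum : t k + t (f k) = t m + t m := by
    have h6 := congrArg (fun v : EuclideanSpace ℝ (Fin 8) => v 6 - v 5) heq
    simp only [PiLp.add_apply] at h6
    linarith [hheight k, hheight (f k), hheight m]
  have hin := congrArg (fun v => inner ℝ v (b m)) heq
  simp only [hχ, inner_add_left, real_inner_smul_left,
    inner_self_eq_two_of_mem_L₄ (hmem m)] at hin
  have hlt : ∀ l, l ≠ m → t l * inner ℝ (b l) (b m) < t l * 2 := fun l hl =>
    mul_lt_mul_of_pos_left (inner_lt_of_inner_self_eq (inner_self_eq_two_of_mem_L₄ (hmem l))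
      (inner_self_eq_two_of_mem_L₄ (hmem m)) (hb.ne hl)) (ht l)
  linarith [hlt k hk, hlt (f k) hfk]
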